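/- arXiv:quant-ph/0012115 — 2 statements merged into one kernel-verified Lean document; each statement's English description precedes it below -/
import Mathlib

section
/- Let J be a nonzero completely positive linear map on the d×d complex matrices, given by a Kraus representation J[ρ] = Σᵢ Vᵢ ρ Vᵢ† for a finite family of d×d matrices Vᵢ. Suppose that for every pure density matrix ρ with Tr J[ρ] > 0, the normalized matrix J[ρ]/Tr J[ρ] is a pure density matrix. Then exactly one of the following two forms holds: either there exists a d×d matrix R such that J[ρ] = R ρ R† for all d×d matrices ρ, or there exist a rank-one orthogonal projection P and a positive semidefinite matrix E (namely E = J*[1], the adjoint of J applied to the identity) such that J[ρ] = Tr(ρE) · P for all d×d matrices ρ. -/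
open Matrix
open scoped ComplexOrder
noncomputable section

/-- A density matrix on `ℂ^d`: positive semidefinite with trace 1. -/
def IsDensity {d : ℕ} (ρ : Matrix (Fin d) (Fin d) ℂ) : Prop :=
  ρ.PosSemidef ∧ ρ.trace = 1

/-- A rank-one orthogonal projection. -/
def IsRankOneProj {d : ℕ} (P : Matrix (Fin d) (Fin d) ℂ) : Prop :=
  P.IsHermitian ∧ P * P = P ∧ P.rank = 1

/-- A pure density matrix: a density matrix which is a rank-one orthogonal projection. -/
def IsPure {d : ℕ} (ρ : Matrix (Fin d) (Fin d) ℂ) : Prop :=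
  IsDensity ρ ∧ IsRankOneProj ρ

theorem aux_parallel {F : Type*} [AddCommGroup F] [Module ℂ F] {m : ℕ} {u v w : F} (hu : u ≠ 0)
    (hv : ∀ a : ℂ, v ≠ a • u) (α β γ : Fin m → ℂ)
    (h : ∀ i, α i • u + β i • v = γ i • w) (i j : Fin m) : α i * β j = α j * β i := by
  have li : ∀ a b : ℂ, a • u + b • v = 0 → a = 0 ∧ b = 0 := by
    intro a b hab
    have hb : b = 0 := by
      by_contra hb
      apply hv (-(b⁻¹ * a))
      have h1 : b • v = -(a • u) := eq_neg_of_add_eq_zero_right hab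
      calc v = b⁻¹ • (b • v) := by rw [smul_smul, inv_mul_cancel₀ hb, one_smul]
        _ = _ := by rw [h1, smul_neg, smul_smul, neg_smul]
    subst hb
    simp only [zero_smul, add_zero, smul_eq_zero, hu, or_false] at hab
    exact ⟨hab, rfl⟩
  have key : (γ j * α i - γ i * α j) • u + (γ j * β i - γ i * β j) • v = 0 := by
    have e : (γ j * α i - γ i * α j) • u + (γ j * β i - γ i * β j) • v
        = γ j • (α i • u + β i • v) - γ i • (α j • u + β j • v) := by module
    rw [e, h, h]; module
  obtain ⟨k1, k2⟩ := li _ _ key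
  by_cases hg : γ i = 0
  · have := h i
    rw [hg, zero_smul] at this
    obtain ⟨k3, k4⟩ := li _ _ this
    simp [k3, k4]
  · apply mul_left_cancel₀ hg
    linear_combination β i * k1 - α i * k2

theorem aux_dichotomy {E F : Type*} [AddCommGroup E] [Module ℂ E] [AddCommGroup F] [Module ℂ F]
    {m : ℕ} (V : Fin m → E →ₗ[ℂ] F)
    (h : ∀ x, ∃ (u : F) (α : Fin m → ℂ), ∀ i, V i x = α i • u) :
    (∃ u : F, ∀ i x, ∃ a : ℂ, V i x = a • u) ∨
    (∃ (k : Fin m) (α : Fin m → ℂ), ∀ i x, V i x = α i • V k x) := by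
  by_cases hc : ∃ u : F, ∀ i x, ∃ a : ℂ, V i x = a • u
  · exact Or.inl hc
  right
  push Not at hc
  choose U A hA using h
  obtain ⟨i, x, hx⟩ := hc 0
  have hx0 : V i x ≠ 0 := by simpa using hx 0
  obtain ⟨j, y, hy⟩ := hc (U x)
  have hu : U x ≠ 0 := by
    intro h0; apply hx0; rw [hA, h0, smul_zero]
  have ha : A x i ≠ 0 := by
    intro h0; apply hx0; rw [hA, h0, zero_smul]
  have hv : ∀ a : ℂ, U y ≠ a • U x := by
    intro a h0
    apply hy (A y j * a)
    rw [hA, h0, smul_smul]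
  have hv0 : U y ≠ 0 := by simpa using hv 0
  have hb : A y j ≠ 0 := by
    intro h0; apply hy 0; rw [hA, h0, zero_smul, zero_smul]
  have par : ∀ s t, (∀ a : ℂ, U t ≠ a • U s) → U s ≠ 0 → ∀ p q, A s p * A t q = A s q * A t p := by
    intro s t h1 h2 p q
    refine aux_parallel h2 h1 (A s) (A t) (A (s + t)) (w := U (s + t)) ?_ p q
    intro i
    rw [← hA, ← hA, ← hA, map_add]
  have pxy := par x y hv hu
  have hbi : A y i ≠ 0 := by
    intro h0
    have := pxy i j
    rw [h0, mul_zero] at this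
    exact mul_ne_zero ha hb this
  refine ⟨i, fun k => A x k / A x i, fun k z => ?_⟩
  have fin : A x i * A z k = A x k * A z i → V k z = (A x k / A x i) • V i z := by
    intro e
    rw [hA z k, hA z i, smul_smul]
    congr 1
    field_simp
    linear_combination e
  by_cases c1 : ∀ a : ℂ, U z ≠ a • U x
  · exact fin (par x z c1 hu i k)
  by_cases c2 : ∀ a : ℂ, U z ≠ a • U y
  · apply fin
    have e1 := par y z c2 hv0 i k
    have e2 := pxy i k
    apply mul_left_cancel₀ hbi
    linear_combination A x i * e1 + A z i * e2
  push Not at c1 c2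
  obtain ⟨a, c1⟩ := c1
  obtain ⟨b, c2⟩ := c2
  have hz : U z = 0 := by
    by_cases hb0 : b = 0
    · rw [c2, hb0, zero_smul]
    · exfalso
      apply hv (b⁻¹ * a)
      rw [← smul_smul, ← c1, c2, smul_smul, inv_mul_cancel₀ hb0, one_smul]
  rw [hA, hA z i, hz]; simp

theorem aux_pure {d : ℕ} (u : Fin d → ℂ) (hu : u ≠ 0) :
    IsPure ((star u ⬝ᵥ u)⁻¹ • vecMulVec u (star u)) := by
  have hn : star u ⬝ᵥ u ≠ 0 := by simpa [dotProduct_star_self_eq_zero] using hu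
  have hpos : 0 ≤ (star u ⬝ᵥ u)⁻¹ := inv_nonneg.2 (dotProduct_star_self_nonneg u)
  have hps : ((star u ⬝ᵥ u)⁻¹ • vecMulVec u (star u)).PosSemidef :=
    (posSemidef_vecMulVec_self_star u).smul hpos
  refine ⟨⟨hps, ?_⟩, hps.1, ?_, ?_⟩
  · rw [trace_smul, trace_vecMulVec, dotProduct_comm u, smul_eq_mul, inv_mul_cancel₀ hn]
  · rw [smul_mul_smul_comm, vecMulVec_mul_vecMulVec, vecMulVec_smul, smul_smul]
    congr 1
    field_simp
  · apply le_antisymm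
    · rw [← smul_vecMulVec]
      exact rank_vecMulVec_le _ _
    · rw [Nat.one_le_iff_ne_zero, Ne, Matrix.rank, Submodule.finrank_eq_zero,
        LinearMap.range_eq_bot]
      intro h0
      have := LinearMap.congr_fun h0 u
      simp [smul_mulVec, vecMulVec_mulVec, hn] at this
      exact hu this

theorem aux_local {d m : ℕ} (w : Fin m → Fin d → ℂ) (P : Matrix (Fin d) (Fin d) ℂ)
    (hP : IsRankOneProj P) (c : ℂ) (h : ∑ i, vecMulVec (w i) (star (w i)) = c • P) :
    ∃ (u : Fin d → ℂ) (α : Fin m → ℂ), ∀ i, w i = α i • u := by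
  obtain ⟨hH, hPP, hr⟩ := hP
  have hQ : (1 - P)ᴴ = 1 - P := by
    rw [conjTranspose_sub, conjTranspose_one, hH.eq]
  have h1 : ∑ i, vecMulVec ((1 - P) *ᵥ w i) (star ((1 - P) *ᵥ w i)) = 0 := by
    have : ∀ i, vecMulVec ((1 - P) *ᵥ w i) (star ((1 - P) *ᵥ w i))
        = (1 - P) * vecMulVec (w i) (star (w i)) * (1 - P) := by
      intro i
      rw [mul_vecMulVec, vecMulVec_mul, star_mulVec, hQ]
    simp_rw [this]
    rw [← Finset.sum_mul, ← Finset.mul_sum, h, mul_smul_comm, sub_mul, one_mul, hPP, sub_self,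
      smul_zero, zero_mul]
  have h2 : ∀ i, P *ᵥ w i = w i := by
    have ht := congrArg trace h1
    simp only [trace_sum, trace_vecMulVec, trace_zero] at ht
    rw [Finset.sum_eq_zero_iff_of_nonneg (fun i _ => dotProduct_self_star_nonneg _)] at ht
    intro i
    have := dotProduct_self_star_eq_zero.1 (ht i (Finset.mem_univ _))
    rw [sub_mulVec, one_mulVec, sub_eq_zero] at this
    exact this.symm
  rw [Matrix.rank] at hr
  obtain ⟨u, -, hu⟩ := finrank_eq_one_iff'.1 hr
  have h3 : ∀ i, ∃ a : ℂ, w i = a • (u : Fin d → ℂ) := by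
    intro i
    obtain ⟨a, ha⟩ := hu ⟨w i, ⟨w i, h2 i⟩⟩
    exact ⟨a, (congrArg Subtype.val ha).symm⟩
  choose α hα using h3
  exact ⟨u, α, hα⟩

/-- If a nonzero completely positive map `J` on `d×d` matrices, given by a Kraus
representation `J[ρ] = ∑ i, V i * ρ * (V i)ᴴ`, sends every pure state with
`Tr J[ρ] > 0` to a multiple of a pure state, then either `J[ρ] = R ρ Rᴴ` for some `R`,
or `J[ρ] = Tr(ρ E) • P` for some rank-one orthogonal projection `P` and the positive
semidefinite matrix `E = J*[𝟙] = ∑ i, (V i)ᴴ * V i`. -/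
theorem pure_preserving_CP_map_dichotomy {d m : ℕ}
    (J : Matrix (Fin d) (Fin d) ℂ →ₗ[ℂ] Matrix (Fin d) (Fin d) ℂ)
    (V : Fin m → Matrix (Fin d) (Fin d) ℂ)
    (hKraus : ∀ ρ, J ρ = ∑ i, V i * ρ * (V i)ᴴ)
    (hJ : J ≠ 0)
    (hpure : ∀ ρ, IsPure ρ → 0 < (J ρ).trace.re →
      IsPure (((J ρ).trace)⁻¹ • J ρ)) :
    (∃ R : Matrix (Fin d) (Fin d) ℂ, ∀ ρ, J ρ = R * ρ * Rᴴ) ∨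
    (∃ P E : Matrix (Fin d) (Fin d) ℂ, IsRankOneProj P ∧ E.PosSemidef ∧
      E = ∑ i, (V i)ᴴ * V i ∧ ∀ ρ, J ρ = (ρ * E).trace • P) := by
  have hconj : ∀ (M : Matrix (Fin d) (Fin d) ℂ) (x : Fin d → ℂ),
      M * vecMulVec x (star x) * Mᴴ = vecMulVec (M *ᵥ x) (star (M *ᵥ x)) := by
    intro M x
    rw [mul_vecMulVec, vecMulVec_mul, star_mulVec]
  have hloc : ∀ x : Fin d → ℂ, ∃ (u : Fin d → ℂ) (α : Fin m → ℂ),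
      ∀ i, (V i).mulVecLin x = α i • u := by
    intro x
    simp only [mulVecLin_apply]
    by_cases hx : x = 0
    · exact ⟨0, 0, fun i => by simp [hx]⟩
    have hn : star x ⬝ᵥ x ≠ 0 := by simpa [dotProduct_star_self_eq_zero] using hx
    have hp := aux_pure x hx
    have hs := hpure _ hp
    have hJx : J ((star x ⬝ᵥ x)⁻¹ • vecMulVec x (star x)) =
        (star x ⬝ᵥ x)⁻¹ • ∑ i, vecMulVec (V i *ᵥ x) (star (V i *ᵥ x)) := by
      rw [map_smul, hKraus]; simp_rw [hconj]
    have hpsd : (J ((star x ⬝ᵥ x)⁻¹ • vecMulVec x (star x))).PosSemidef := by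
      rw [hKraus]
      exact posSemidef_sum _ fun i _ => hp.1.1.mul_mul_conjTranspose_same _
    set ρ := (star x ⬝ᵥ x)⁻¹ • vecMulVec x (star x) with hρ
    have ht := hpsd.trace_nonneg
    have hS : ∑ i, vecMulVec (V i *ᵥ x) (star (V i *ᵥ x)) = (star x ⬝ᵥ x) • J ρ := by
      rw [hJx, smul_smul, mul_inv_cancel₀ hn, one_smul]
    by_cases h0 : (J ρ).trace = 0
    · have hz : J ρ = 0 := hpsd.trace_eq_zero_iff.1 h0
      rw [hz, smul_zero] at hS
      have ht := congrArg trace hS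
      simp only [trace_sum, trace_vecMulVec, trace_zero] at ht
      rw [Finset.sum_eq_zero_iff_of_nonneg (fun i _ => dotProduct_self_star_nonneg _)] at ht
      refine ⟨0, 0, fun i => ?_⟩
      simpa using dotProduct_self_star_eq_zero.1 (ht i (Finset.mem_univ _))
    · have hpos : 0 < (J ρ).trace.re := (Complex.pos_iff.1 (lt_of_le_of_ne ht (Ne.symm h0))).1
      refine aux_local _ _ (hs hpos).2 ((star x ⬝ᵥ x) * (J ρ).trace) ?_
      rw [hS, smul_smul, mul_assoc, mul_inv_cancel₀ h0, mul_one]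
  rcases aux_dichotomy (fun i => (V i).mulVecLin) hloc with ⟨u, hu⟩ | ⟨k, α, hα⟩
  · right
    have hu0 : u ≠ 0 := by
      rintro rfl
      apply hJ
      have hV : ∀ i, V i = 0 := by
        intro i
        apply Matrix.ext_of_mulVec_single
        intro j
        obtain ⟨a, ha⟩ := hu i (Pi.single j 1)
        rw [smul_zero, mulVecLin_apply] at ha
        rw [ha, zero_mulVec]
      ext1 ρ
      simp [hKraus, hV]
    have hn : star u ⬝ᵥ u ≠ 0 := by simpa [dotProduct_star_self_eq_zero] using hu0
    have hp := aux_pure u hu0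
    set P := (star u ⬝ᵥ u)⁻¹ • vecMulVec u (star u) with hP
    have hPu : P *ᵥ u = u := by
      rw [hP, smul_mulVec, vecMulVec_mulVec]
      simp [smul_smul, hn]
    have hPV : ∀ i, P * V i = V i := by
      intro i
      apply Matrix.ext_of_mulVec_single
      intro j
      obtain ⟨a, ha⟩ := hu i (Pi.single j 1)
      rw [mulVecLin_apply] at ha
      rw [← mulVec_mulVec, ha, mulVec_smul, hPu]
    refine ⟨P, _, hp.2, posSemidef_sum _ fun i _ => posSemidef_conjTranspose_mul_self _, rfl,
      fun ρ => ?_⟩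
    have hPJP : P * J ρ * P = J ρ := by
      rw [hKraus, Finset.mul_sum, Finset.sum_mul]
      refine Finset.sum_congr rfl fun i _ => ?_
      have hVP : (V i)ᴴ * P = (V i)ᴴ := by
        have := congrArg conjTranspose (hPV i)
        rwa [conjTranspose_mul, hp.2.1.eq] at this
      rw [← mul_assoc, ← mul_assoc, hPV, mul_assoc, hVP]
    have hc : ∃ c : ℂ, J ρ = c • P := by
      refine ⟨(star u ⬝ᵥ u)⁻¹ * (star u ⬝ᵥ (J ρ *ᵥ u)), ?_⟩
      conv_lhs => rw [← hPJP]
      rw [hP, smul_mul_assoc, smul_mul_assoc, mul_smul_comm, mul_assoc, mul_vecMulVec,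
        vecMulVec_mul_vecMulVec, vecMulVec_smul]
      simp only [smul_smul]
      congr 1
      ring
    obtain ⟨c, hc⟩ := hc
    have htr : (J ρ).trace = c := by rw [hc, trace_smul, hp.1.2, smul_eq_mul, mul_one]
    rw [hc, ← htr, hKraus, Finset.mul_sum, trace_sum, trace_sum]
    congr 1
    refine Finset.sum_congr rfl fun i _ => ?_
    rw [mul_assoc, trace_mul_comm, mul_assoc]
  · left
    have hV : ∀ i, V i = α i • V k := by
      intro i
      apply Matrix.ext_of_mulVec_single
      intro j
      have := hα i (Pi.single j 1)
      rw [mulVecLin_apply, mulVecLin_apply] at this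
      rw [this, smul_mulVec]
    refine ⟨((Real.sqrt (∑ i, Complex.normSq (α i)) : ℝ) : ℂ) • V k, fun ρ => ?_⟩
    have hs : (((Real.sqrt (∑ i, Complex.normSq (α i)) : ℝ) : ℂ) *
        ((Real.sqrt (∑ i, Complex.normSq (α i)) : ℝ) : ℂ)) = ∑ i, α i * star (α i) := by
      rw [← Complex.ofReal_mul, Real.mul_self_sqrt (Finset.sum_nonneg fun i _ => Complex.normSq_nonneg _)]
      push_cast
      exact Finset.sum_congr rfl fun i _ => (Complex.mul_conj _).symm
    have e1 : ∀ c : ℂ, (c • V k) * ρ * (c • V k)ᴴ = (c * star c) • (V k * ρ * (V k)ᴴ) := by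
      intro c
      rw [conjTranspose_smul, smul_mul_assoc, smul_mul_assoc, mul_smul_comm, smul_smul]
    rw [e1, hKraus]
    have e2 : ∀ i, V i * ρ * (V i)ᴴ = (α i * star (α i)) • (V k * ρ * (V k)ᴴ) := by
      intro i
      rw [← e1, ← hV]
    rw [Finset.sum_congr rfl fun i _ => e2 i, ← Finset.sum_smul, ← hs]
    simp
end
end

section
/- Let A, J, K be finite index sets, let p_α ≥ 0 for α ∈ A with Σ_α p_α = 1, and for each α let m_{jα} (j ∈ J) be real numbers and ν_{kα} ≥ 0 (k ∈ K) be nonnegative reals. Set m_j = Σ_α p_α m_{jα} and ν_k = Σ_α p_α ν_{kα}, and assume ν_k > 0 for all k. Then, with the convention 0 ln 0 := 0: Σ_α p_α [ (1/2)Σ_j m_{jα}² + Σ_k ν_{kα} ln ν_{kα} ] − [ (1/2)Σ_j m_j² + Σ_k ν_k ln ν_k ] = Σ_α p_α [ (1/2)Σ_j (m_{jα} − m_j)² + Σ_k ν_k (1 − ν_{kα}/ν_k + (ν_{kα}/ν_k) ln(ν_{kα}/ν_k)) ], and this common value is nonnegative. -/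
noncomputable section

/-- The algebraic identity and inequality behind formula (3.10): the difference between the
mean of `(1/2)∑ⱼ m_{jα}² + ∑ₖ ν_{kα} ln ν_{kα}` and the corresponding expression for the
averaged coefficients equals a manifestly nonnegative expression (with the convention
`0 ln 0 = 0`). -/
theorem classical_info_derivative_identity_nonneg
    {A J K : Type*} [Fintype A] [Fintype J] [Fintype K]
    (p : A → ℝ) (hp : ∀ α, 0 ≤ p α) (hpsum : ∑ α, p α = 1)
    (m : J → A → ℝ) (ν : K → A → ℝ) (hν : ∀ k α, 0 ≤ ν k α)
    (mbar : J → ℝ) (νbar : K → ℝ)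
    (hmbar : ∀ j, mbar j = ∑ α, p α * m j α)
    (hνbar : ∀ k, νbar k = ∑ α, p α * ν k α)
    (hνpos : ∀ k, 0 < νbar k) :
    (∑ α, p α * ((1 / 2) * ∑ j, (m j α) ^ 2 + ∑ k, ν k α * Real.log (ν k α))
        - ((1 / 2) * ∑ j, (mbar j) ^ 2 + ∑ k, νbar k * Real.log (νbar k))
      = ∑ α, p α * ((1 / 2) * ∑ j, (m j α - mbar j) ^ 2
          + ∑ k, νbar k * (1 - ν k α / νbar k
              + (ν k α / νbar k) * Real.log (ν k α / νbar k)))) ∧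
    0 ≤ ∑ α, p α * ((1 / 2) * ∑ j, (m j α - mbar j) ^ 2
          + ∑ k, νbar k * (1 - ν k α / νbar k
              + (ν k α / νbar k) * Real.log (ν k α / νbar k))) := by
  have swap : ∀ (f : J → A → ℝ) (g : K → A → ℝ),
      ∑ α, p α * ((1 / 2) * ∑ j, f j α + ∑ k, g k α)
        = (1 / 2) * ∑ j, ∑ α, p α * f j α + ∑ k, ∑ α, p α * g k α := by
    intro f g
    rw [Finset.sum_comm (s := (Finset.univ : Finset J)),
      Finset.sum_comm (s := (Finset.univ : Finset K)), Finset.mul_sum, ← Finset.sum_add_distrib]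
    refine Finset.sum_congr rfl fun α _ => ?_
    rw [← Finset.mul_sum, ← Finset.mul_sum]
    ring
  constructor
  · rw [swap (fun j α => (m j α) ^ 2) (fun k α => ν k α * Real.log (ν k α)),
      swap (fun j α => (m j α - mbar j) ^ 2) (fun k α => νbar k * (1 - ν k α / νbar k
              + (ν k α / νbar k) * Real.log (ν k α / νbar k)))]
    have h1 : ∀ j, ∑ α, p α * (m j α - mbar j) ^ 2
        = ∑ α, p α * (m j α) ^ 2 - (mbar j) ^ 2 := by
      intro j
      have : ∀ α, p α * (m j α - mbar j) ^ 2
          = p α * (m j α) ^ 2 - 2 * mbar j * (p α * m j α) + (mbar j) ^ 2 * p α := by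
        intro α; ring
      simp only [this]
      rw [Finset.sum_add_distrib, Finset.sum_sub_distrib, ← Finset.mul_sum, ← Finset.mul_sum,
        ← hmbar, hpsum]
      ring
    have h2 : ∀ k, ∑ α, p α * (νbar k * (1 - ν k α / νbar k
              + (ν k α / νbar k) * Real.log (ν k α / νbar k)))
        = ∑ α, p α * (ν k α * Real.log (ν k α)) - νbar k * Real.log (νbar k) := by
      intro k
      have hk := (hνpos k).ne'
      have : ∀ α, p α * (νbar k * (1 - ν k α / νbar k
              + (ν k α / νbar k) * Real.log (ν k α / νbar k)))
          = p α * (ν k α * Real.log (ν k α)) - (1 + Real.log (νbar k)) * (p α * ν k α)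
            + νbar k * p α := by
        intro α
        rcases eq_or_ne (ν k α) 0 with h | h
        · simp [h]; ring
        · rw [Real.log_div h hk]
          field_simp
          ring
      simp only [this]
      rw [Finset.sum_add_distrib, Finset.sum_sub_distrib, ← Finset.mul_sum, ← Finset.mul_sum,
        ← hνbar, hpsum]
      ring
    simp only [h1, h2, Finset.sum_sub_distrib]
    ring
  · have key : ∀ x : ℝ, 0 ≤ x → 0 ≤ 1 - x + x * Real.log x := by
      intro x hx
      rcases hx.eq_or_lt with h | h
      · simp [← h]
      · have h1 := mul_le_mul_of_nonneg_left (Real.one_sub_inv_le_log_of_pos h) hx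
        have h2 : x * (1 - x⁻¹) = x - 1 := by field_simp
        linarith
    refine Finset.sum_nonneg fun α _ => mul_nonneg (hp α) (add_nonneg ?_ ?_)
    · positivity
    · exact Finset.sum_nonneg fun k _ => mul_nonneg (hνpos k).le
        (key _ (div_nonneg (hν k α) (hνpos k).le))
end
end
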